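/- Let μ > 0, κ ∈ ℂ and j, k ∈ ℤ. Define W'_μ := {(z₁,z₂,z₃) ∈ ℂ³ : z₂ ≠ 0, z₃ ≠ 0, |z₁ − exp(i·log|z₂z₃|²)| < 1, −μ < log|z₂|² < μ, −μ < log|z₃|² < μ}. Then the function z ↦ E_κ(z)·z₂^j·z₃^k is square-integrable on W'_μ with respect to Lebesgue measure on ℂ³ if and only if Re(κ) > −1. -/

import Mathlib

open Complex MeasureTheory

/-- `log|z₂z₃|²` as a real number. -/
noncomputable def Lofz (z : ℂ × ℂ × ℂ) : ℝ :=
  Real.log (‖z.2.1 * z.2.2‖ ^ 2)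

/-- The truncated worm `W'_μ`. -/
noncomputable def wormTrunc (μ : ℝ) : Set (ℂ × ℂ × ℂ) :=
  {z | z.2.1 ≠ 0 ∧ z.2.2 ≠ 0 ∧
    ‖z.1 - Complex.exp (Complex.I * (Lofz z : ℂ))‖ < 1 ∧
    -μ < Real.log (‖z.2.1‖ ^ 2) ∧ Real.log (‖z.2.1‖ ^ 2) < μ ∧
    -μ < Real.log (‖z.2.2‖ ^ 2) ∧ Real.log (‖z.2.2‖ ^ 2) < μ}

/-- The holomorphic logarithm `ℓ`, defined via the principal branch `Log`. -/
noncomputable def ellfun (z : ℂ × ℂ × ℂ) : ℂ :=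
  Complex.log (z.1 * Complex.exp (-(Complex.I * (Lofz z : ℂ)))) + Complex.I * (Lofz z : ℂ)

/-- The holomorphic power `E_κ = exp(κℓ)`. -/
noncomputable def Efun (κ : ℂ) (z : ℂ × ℂ × ℂ) : ℂ :=
  Complex.exp (κ * ellfun z)

lemma worm_measurable_Lofz : Measurable Lofz := by
  unfold Lofz
  fun_prop

lemma worm_measurableSet (μ : ℝ) : MeasurableSet (wormTrunc μ) := by
  have hL := worm_measurable_Lofz
  have m1 : MeasurableSet {z : ℂ × ℂ × ℂ | z.2.1 ≠ 0} :=
    (measurableSet_eq_fun (f := fun z : ℂ × ℂ × ℂ => z.2.1) (by fun_prop) measurable_const).compl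
  have m2 : MeasurableSet {z : ℂ × ℂ × ℂ | z.2.2 ≠ 0} :=
    (measurableSet_eq_fun (f := fun z : ℂ × ℂ × ℂ => z.2.2) (by fun_prop) measurable_const).compl
  have m3 : MeasurableSet
      {z : ℂ × ℂ × ℂ | ‖z.1 - Complex.exp (Complex.I * (Lofz z : ℂ))‖ < 1} :=
    measurableSet_lt (by fun_prop) (by fun_prop)
  have m4 : MeasurableSet {z : ℂ × ℂ × ℂ | -μ < Real.log (‖z.2.1‖ ^ 2)} :=
    measurableSet_lt (by fun_prop) (by fun_prop)
  have m5 : MeasurableSet {z : ℂ × ℂ × ℂ | Real.log (‖z.2.1‖ ^ 2) < μ} :=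
    measurableSet_lt (by fun_prop) (by fun_prop)
  have m6 : MeasurableSet {z : ℂ × ℂ × ℂ | -μ < Real.log (‖z.2.2‖ ^ 2)} :=
    measurableSet_lt (by fun_prop) (by fun_prop)
  have m7 : MeasurableSet {z : ℂ × ℂ × ℂ | Real.log (‖z.2.2‖ ^ 2) < μ} :=
    measurableSet_lt (by fun_prop) (by fun_prop)
  exact m1.inter (m2.inter (m3.inter (m4.inter (m5.inter (m6.inter m7)))))

lemma worm_measurable_f (κ : ℂ) (j k : ℤ) : Measurable (fun z : ℂ × ℂ × ℂ =>
    ‖Efun κ z * z.2.1 ^ j * z.2.2 ^ k‖ ^ 2) := by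
  have hL := worm_measurable_Lofz
  have h2 : Measurable (fun z : ℂ × ℂ × ℂ => z.2.1 ^ j) :=
    (by fun_prop : Measurable fun z : ℂ × ℂ × ℂ => z.2.1).pow_const j
  have h3 : Measurable (fun z : ℂ × ℂ × ℂ => z.2.2 ^ k) :=
    (by fun_prop : Measurable fun z : ℂ × ℂ × ℂ => z.2.2).pow_const k
  have hE : Measurable (Efun κ) := by
    unfold Efun ellfun
    fun_prop
  fun_prop

lemma worm_fst_ne {μ : ℝ} {z : ℂ × ℂ × ℂ} (hz : z ∈ wormTrunc μ) : z.1 ≠ 0 := by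
  intro h
  have := hz.2.2.1
  rw [h, zero_sub, norm_neg, mul_comm, Complex.norm_exp_ofReal_mul_I] at this
  exact lt_irrefl _ this

lemma worm_exists_bound {μ : ℝ} (κ : ℂ) (j k : ℤ) : ∃ M : ℝ, ∀ z ∈ wormTrunc μ,
    ‖Efun κ z * z.2.1 ^ j * z.2.2 ^ k‖ ^ 2 ≤ Real.exp M * ‖z.1‖ ^ (2 * κ.re) ∧
    ‖z.1‖ ^ (2 * κ.re) ≤ Real.exp M * ‖Efun κ z * z.2.1 ^ j * z.2.2 ^ k‖ ^ 2 := by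
  refine ⟨2 * (|κ.im| * (Real.pi + 2 * μ)) + |(j : ℝ)| * μ + |(k : ℝ)| * μ, fun z hz => ?_⟩
  have h1 := worm_fst_ne hz
  obtain ⟨h2, h3, -, ha, hb, hc, hd⟩ := hz
  have n1 : 0 < ‖z.1‖ := norm_pos_iff.2 h1
  have n2 : 0 < ‖z.2.1‖ := norm_pos_iff.2 h2
  have n3 : 0 < ‖z.2.2‖ := norm_pos_iff.2 h3
  have hL : Lofz z = Real.log (‖z.2.1‖ ^ 2) + Real.log (‖z.2.2‖ ^ 2) := by
    unfold Lofz
    rw [norm_mul, mul_pow, Real.log_mul (by positivity) (by positivity)]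
  set p := Real.log (‖z.2.1‖ ^ 2) with hp
  set q := Real.log (‖z.2.2‖ ^ 2) with hq
  set θ := Complex.arg (z.1 * Complex.exp (-(Complex.I * (Lofz z : ℂ)))) with hθ
  have hre : (ellfun z).re = Real.log ‖z.1‖ := by
    unfold ellfun
    rw [Complex.add_re, Complex.log_re, norm_mul]
    have : -(Complex.I * (Lofz z : ℂ)) = ((-Lofz z : ℝ) : ℂ) * Complex.I := by push_cast; ring
    rw [this, Complex.norm_exp_ofReal_mul_I]
    simp
  have him : (ellfun z).im = θ + Lofz z := by
    unfold ellfun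
    rw [Complex.add_im, Complex.log_im]
    simp [hθ]
  have e2 : ‖z.2.1 ^ j‖ ^ 2 = Real.exp (j * p) := by
    rw [norm_zpow, hp, Real.log_pow, ← Real.rpow_intCast, Real.rpow_def_of_pos n2, ← Real.exp_nat_mul]
    congr 1; push_cast; ring
  have e3 : ‖z.2.2 ^ k‖ ^ 2 = Real.exp (k * q) := by
    rw [norm_zpow, hq, Real.log_pow, ← Real.rpow_intCast, Real.rpow_def_of_pos n3, ← Real.exp_nat_mul]
    congr 1; push_cast; ring
  have e1 : ‖Efun κ z‖ ^ 2 =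
      Real.exp (2 * (κ.re * Real.log ‖z.1‖ - κ.im * (θ + Lofz z))) := by
    unfold Efun
    rw [Complex.norm_exp, Complex.mul_re, hre, him, ← Real.exp_nat_mul]
    norm_num
  have b1 : |κ.im * (θ + Lofz z)| ≤ |κ.im| * (Real.pi + 2 * μ) := by
    rw [abs_mul]
    gcongr
    have := Complex.abs_arg_le_pi (z.1 * Complex.exp (-(Complex.I * (Lofz z : ℂ))))
    rw [← hθ, abs_le] at this
    rw [hL, abs_le]
    constructor <;> linarith
  have b2 : |(j : ℝ) * p| ≤ |(j : ℝ)| * μ := by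
    rw [abs_mul]; gcongr; rw [abs_le]; constructor <;> linarith
  have b3 : |(k : ℝ) * q| ≤ |(k : ℝ)| * μ := by
    rw [abs_mul]; gcongr; rw [abs_le]; constructor <;> linarith
  rw [abs_le] at b1 b2 b3
  rw [norm_mul, norm_mul, mul_pow, mul_pow, e1, e2, e3, Real.rpow_def_of_pos n1,
    ← Real.exp_add, ← Real.exp_add, ← Real.exp_add, ← Real.exp_add, Real.exp_le_exp,
    Real.exp_le_exp]
  constructor <;> linarith

lemma worm_integrable_iff (μ : ℝ) (κ : ℂ) (j k : ℤ) :
    IntegrableOn (fun z : ℂ × ℂ × ℂ =>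
        ‖Efun κ z * z.2.1 ^ j * z.2.2 ^ k‖ ^ 2) (wormTrunc μ) volume ↔
    IntegrableOn (fun z : ℂ × ℂ × ℂ => ‖z.1‖ ^ (2 * κ.re)) (wormTrunc μ) volume := by
  obtain ⟨M, hM⟩ := worm_exists_bound (μ := μ) κ j k
  constructor
  · intro h
    refine Integrable.mono' (h.const_mul (Real.exp M))
      (Measurable.aestronglyMeasurable (by fun_prop)) ?_
    refine ae_restrict_of_forall_mem (worm_measurableSet μ) fun z hz => ?_
    rw [Real.norm_of_nonneg (by positivity)]
    exact (hM z hz).2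
  · intro h
    refine Integrable.mono' (h.const_mul (Real.exp M))
      (worm_measurable_f κ j k).aestronglyMeasurable ?_
    refine ae_restrict_of_forall_mem (worm_measurableSet μ) fun z hz => ?_
    rw [Real.norm_of_nonneg (by positivity)]
    exact (hM z hz).1

lemma worm_ball_iff {r s : ℝ} (hr : 0 < r) :
    IntegrableOn (fun w : ℂ => ‖w‖ ^ s) (Metric.ball 0 r) volume ↔ -2 < s := by
  rw [integrableOn_fun_norm_addHaar volume (f := fun x : ℝ => x ^ s),
    Complex.finrank_real_complex]
  have : IntegrableOn (fun y : ℝ => y ^ (2 - 1) • y ^ s) (Set.Ioo 0 r) ↔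
      IntegrableOn (fun y : ℝ => y ^ (s + 1)) (Set.Ioo 0 r) := by
    refine integrableOn_congr_fun (fun y hy => ?_) measurableSet_Ioo
    simp only [smul_eq_mul]
    rw [Real.rpow_add_one hy.1.ne']
    norm_num [mul_comm]
  rw [this, intervalIntegral.integrableOn_Ioo_rpow_iff hr]
  constructor <;> intro h <;> linarith

/-- A quarter-plane sector. -/
def wormSector : Set ℂ := {w | |w.im| ≤ w.re ∧ 0 < w.re ∧ ‖w‖ < 1 / 4}

lemma worm_rot {s : ℝ} (h : IntegrableOn (fun w : ℂ => ‖w‖ ^ s) wormSector volume) (u : Circle) :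
    IntegrableOn (fun w : ℂ => ‖w‖ ^ s) ((rotation u) ⁻¹' wormSector) volume := by
  have := ((rotation u).measurePreserving.integrableOn_comp_preimage
    (rotation u).toHomeomorph.measurableEmbedding (f := fun w : ℂ => ‖w‖ ^ s) (s := wormSector)).2 h
  simpa [Function.comp_def, Circle.norm_coe] using this

lemma worm_sector {s : ℝ} (h : IntegrableOn (fun w : ℂ => ‖w‖ ^ s) wormSector volume) :
    -2 < s := by
  rw [← worm_ball_iff (r := 1 / 4) (by norm_num)]
  have h0 : IntegrableOn (fun w : ℂ => ‖w‖ ^ s) {0} volume := by simp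
  let u : Circle := ⟨Complex.I, by simp [Submonoid.unitSphere]⟩
  refine ((((h0.union (worm_rot h 1)).union (worm_rot h u)).union (worm_rot h (u * u))).union
    (worm_rot h (u * u * u))).mono_set ?_
  intro w hw
  have hn : ‖w‖ < 1 / 4 := by simpa using hw
  have hu : (u : ℂ) = Complex.I := rfl
  by_cases hw0 : w = 0
  · simp [hw0]
  have hw1 : w.re ≠ 0 ∨ w.im ≠ 0 := by
    by_contra! hc
    exact hw0 (Complex.ext hc.1 hc.2)
  simp only [Set.mem_union, Set.mem_preimage, wormSector, Set.mem_ofPred_eq, rotation_apply,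
    Circle.coe_mul, hu, norm_mul, Complex.norm_I, Circle.coe_one, one_mul, norm_one,
    Complex.mul_re, Complex.mul_im, Complex.I_re, Complex.I_im, hn, and_true, abs_le,
    Set.mem_singleton_iff, hw0, false_or]
  norm_num
  grind

lemma worm_sector_sub {w : ℂ} (hw : w ∈ wormSector) {L : ℝ} (hL : |L| ≤ 1 / 2) :
    ‖w - Complex.exp (Complex.I * (L : ℂ))‖ < 1 := by
  obtain ⟨h1, h2, h3⟩ := hw
  have hx : w.re < 1 / 4 := lt_of_le_of_lt (Complex.re_le_norm w) h3
  have hc := Real.one_sub_sq_div_two_le_cos (x := L)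
  have hs : |Real.sin L| ≤ |L| := Real.abs_sin_le_abs
  have hsq := Real.sin_sq_add_cos_sq L
  have hL2 : L ^ 2 ≤ 1 / 4 := by
    rw [← sq_abs]; nlinarith [abs_nonneg L]
  have hys : -(w.re * (1 / 2)) ≤ w.im * Real.sin L := by
    have : |w.im * Real.sin L| ≤ w.re * (1 / 2) := by
      rw [abs_mul]; gcongr; linarith
    exact (abs_le.1 this).1
  have hy2 : w.im ^ 2 ≤ w.re ^ 2 := by rw [← sq_abs]; gcongr
  have : ‖w - Complex.exp (Complex.I * (L : ℂ))‖ ^ 2 < 1 := by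
    rw [Complex.sq_norm, Complex.normSq_apply, mul_comm Complex.I, Complex.sub_re, Complex.sub_im,
      Complex.exp_ofReal_mul_I_re, Complex.exp_ofReal_mul_I_im]
    nlinarith
  nlinarith [norm_nonneg (w - Complex.exp (Complex.I * (L : ℂ)))]

/-- An open annulus around the unit circle. -/
def wormAnn (δ : ℝ) : Set ℂ := {w | Real.exp (-δ / 2) < ‖w‖ ∧ ‖w‖ < Real.exp (δ / 2)}

lemma worm_ann_log {δ : ℝ} {w : ℂ} (hw : w ∈ wormAnn δ) :
    w ≠ 0 ∧ -δ < Real.log (‖w‖ ^ 2) ∧ Real.log (‖w‖ ^ 2) < δ := by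
  have h0 : 0 < ‖w‖ := (Real.exp_pos _).trans hw.1
  have h1 := (Real.lt_log_iff_exp_lt h0).2 hw.1
  have h2 := (Real.log_lt_iff_lt_exp h0).2 hw.2
  refine ⟨norm_pos_iff.1 h0, ?_, ?_⟩ <;> rw [Real.log_pow] <;> push_cast <;> linarith

lemma worm_ann_pos {δ : ℝ} (hδ : 0 < δ) : 0 < volume (wormAnn δ) := by
  have ho : IsOpen (wormAnn δ) :=
    (isOpen_lt continuous_const continuous_norm).inter (isOpen_lt continuous_norm continuous_const)
  refine ho.measure_pos _ ⟨1, ?_, ?_⟩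
  · rw [norm_one, Real.exp_lt_one_iff]; linarith
  · rw [norm_one, Real.one_lt_exp_iff]; linarith

/-- `E_κ(z)·z₂^j·z₃^k` is square-integrable on `W'_μ` if and only if `Re κ > −1`. -/
theorem Efun_memL2_iff (μ : ℝ) (hμ : 0 < μ) (κ : ℂ) (j k : ℤ) :
    IntegrableOn (fun z : ℂ × ℂ × ℂ =>
        ‖Efun κ z * z.2.1 ^ j * z.2.2 ^ k‖ ^ 2) (wormTrunc μ) volume ↔
      -1 < κ.re := by
  rw [worm_integrable_iff]
  constructor
  · intro h
    obtain ⟨δ, hδ, hδμ, hδ4⟩ : ∃ δ : ℝ, 0 < δ ∧ δ ≤ μ ∧ δ ≤ 1 / 4 :=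
      ⟨min μ (1 / 4), by positivity, min_le_left _ _, min_le_right _ _⟩
    have hsub : wormSector ×ˢ (wormAnn δ ×ˢ wormAnn δ) ⊆ wormTrunc μ := by
      rintro ⟨a, b, c⟩ ⟨ha, hb, hc⟩
      obtain ⟨b0, b1, b2⟩ := worm_ann_log hb
      obtain ⟨c0, c1, c2⟩ := worm_ann_log hc
      simp only at b0 b1 b2 c0 c1 c2
      refine ⟨b0, c0, worm_sector_sub ha ?_, ?_, ?_, ?_, ?_⟩
      · have n2 : 0 < ‖b‖ := norm_pos_iff.2 b0
        have n3 : 0 < ‖c‖ := norm_pos_iff.2 c0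
        unfold Lofz
        simp only
        rw [norm_mul, mul_pow, Real.log_mul (by positivity) (by positivity), abs_le]
        constructor <;> linarith
      all_goals simp only; linarith
    have h' := h.mono_set hsub
    rw [IntegrableOn, Measure.volume_eq_prod, ← Measure.prod_restrict] at h'
    have h'' := Integrable.of_comp_fst (f := fun w : ℂ => ‖w‖ ^ (2 * κ.re)) h' (by
      rw [Ne, Measure.restrict_eq_zero, Measure.volume_eq_prod, Measure.prod_prod]
      have := (worm_ann_pos hδ).ne'
      simp [this])
    have := worm_sector h''
    linarith
  · intro h
    have hb : IntegrableOn (fun w : ℂ => ‖w‖ ^ (2 * κ.re)) (Metric.ball 0 2) volume :=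
      (worm_ball_iff (by norm_num)).2 (by linarith)
    have hfin : IsFiniteMeasure ((volume : Measure (ℂ × ℂ)).restrict
        (Metric.ball 0 (Real.exp (μ / 2)))) := ⟨by
      rw [Measure.restrict_apply_univ]; exact measure_ball_lt_top⟩
    have hp := Integrable.comp_fst hb
      ((volume : Measure (ℂ × ℂ)).restrict (Metric.ball 0 (Real.exp (μ / 2))))
    rw [Measure.prod_restrict, ← Measure.volume_eq_prod] at hp
    refine IntegrableOn.mono_set hp ?_
    rintro ⟨a, b, c⟩ ⟨b0, c0, ha, -, hb2, -, hc2⟩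
    simp only at b0 c0 ha hb2 hc2
    have n2 : 0 < ‖b‖ := norm_pos_iff.2 b0
    have n3 : 0 < ‖c‖ := norm_pos_iff.2 c0
    rw [Real.log_pow] at hb2 hc2
    push_cast at hb2 hc2
    refine ⟨?_, ?_⟩
    · rw [mul_comm] at ha
      have := norm_sub_norm_le a (Complex.exp ((Lofz (a, b, c) : ℂ) * Complex.I))
      rw [Complex.norm_exp_ofReal_mul_I] at this
      simp only [mem_ball_zero_iff]
      linarith
    · simp only [mem_ball_zero_iff, Prod.norm_mk, max_lt_iff]
      exact ⟨(Real.log_lt_iff_lt_exp n2).1 (by linarith), (Real.log_lt_iff_lt_exp n3).1 (by linarith)⟩
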